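/- Let d ≥ 2 and k ≥ 1 be integers and λ = λ_c = d^d/(k(d−1)^{d+1}). Let g(x) = kλ(1 + kλ/(1+x)^d)^{−d} (the two-step recursion g = f ∘ f) and x̂ = 1/(d−1). Then g(x̂) = x̂, the first derivative g'(x̂) = 1, the second derivative g''(x̂) = 0, and the third derivative g'''(x̂) = −(d+1)(d−1)³/d². -/

import Mathlib

/-- The recursion `x ↦ c / (1 + x) ^ d` has logarithmic derivative `-d / (1 + x)`. -/
theorem hasDerivAt_div_one_add_pow (c : ℝ) (d : ℕ) {x : ℝ} (hx : 1 + x ≠ 0) :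
    HasDerivAt (fun t : ℝ => c / (1 + t) ^ d) (-d * (c / (1 + x) ^ d) / (1 + x)) x := by
  have h1 : HasDerivAt (fun t : ℝ => (1 + t) ^ d) (d * (1 + x) ^ (d - 1) * 1) x :=
    ((hasDerivAt_id x).const_add 1).pow d
  refine HasDerivAt.congr_deriv ((hasDerivAt_const x c).div h1 (pow_ne_zero d hx)) ?_
  rcases d with _ | n
  · simp
  · simp only [Nat.add_sub_cancel]
    field_simp
    ring

/-- The first three derivatives of `z` on an open set where `z' = d² z w u`,
`w' = -d w (1 - w) u` and `u' = -u²`. -/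
theorem derivs_of_logistic_system {d : ℝ} {s : Set ℝ} (hs : IsOpen s) {z w u : ℝ → ℝ}
    (hz : ∀ x ∈ s, HasDerivAt z (d ^ 2 * (z x * w x * u x)) x)
    (hw : ∀ x ∈ s, HasDerivAt w (-d * (w x * (1 - w x) * u x)) x)
    (hu : ∀ x ∈ s, HasDerivAt u (-(u x) ^ 2) x) {x : ℝ} (hx : x ∈ s) :
    deriv z x = d ^ 2 * (z x * w x * u x) ∧
    iteratedDeriv 2 z x = d ^ 2 * (d + 1) * (z x * w x * u x ^ 2 * (d * w x - 1)) ∧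
    iteratedDeriv 3 z x = d ^ 2 * (d + 1) *
      ((d ^ 2 * (z x * w x * u x) * w x * u x ^ 2
          + z x * (-d * (w x * (1 - w x) * u x)) * u x ^ 2
          - 2 * (z x * w x * u x ^ 3)) * (d * w x - 1)
        - d ^ 2 * (z x * w x ^ 2 * (1 - w x) * u x ^ 3)) := by
  have h1 : ∀ t ∈ s, deriv z t = d ^ 2 * (z t * w t * u t) := fun t ht => (hz t ht).deriv
  have h2 : ∀ t ∈ s, iteratedDeriv 2 z t =
      d ^ 2 * (d + 1) * (z t * w t * u t ^ 2 * (d * w t - 1)) := by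
    intro t ht
    rw [iteratedDeriv_succ, iteratedDeriv_one,
      (Filter.eventuallyEq_of_mem (hs.mem_nhds ht) h1).deriv_eq]
    refine HasDerivAt.deriv ?_
    refine HasDerivAt.congr_deriv ((((hz t ht).mul (hw t ht)).mul (hu t ht)).const_mul (d ^ 2)) ?_
    simp only [Pi.mul_apply]
    ring
  refine ⟨h1 x hx, h2 x hx, ?_⟩
  rw [iteratedDeriv_succ, (Filter.eventuallyEq_of_mem (hs.mem_nhds hx) h2).deriv_eq]
  refine HasDerivAt.deriv ?_
  refine HasDerivAt.congr_deriv (((((hz x hx).mul (hw x hx)).mul ((hu x hx).pow 2)).mul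
    (((hw x hx).const_mul d).sub_const 1)).const_mul (d ^ 2 * (d + 1))) ?_
  simp only [Pi.mul_apply, Pi.pow_apply]
  push_cast
  ring

/-- For `d ≥ 2`, `k ≥ 1` and `λ = λ_c = d^d/(k(d−1)^(d+1))`, the two-step
recursion `g(x) = kλ/(1 + kλ/(1+x)^d)^d` with `x̂ = 1/(d−1)` satisfies `g(x̂) = x̂`,
`g'(x̂) = 1`, `g''(x̂) = 0` and `g'''(x̂) = −(d+1)(d−1)³/d²`. -/
theorem stmt10 (d k : ℕ) (hd : 2 ≤ d) (hk : 1 ≤ k) (lam : ℝ)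
    (hlam : lam = (d : ℝ) ^ d / ((k : ℝ) * ((d : ℝ) - 1) ^ (d + 1)))
    (g : ℝ → ℝ)
    (hg : ∀ x : ℝ, g x = (k : ℝ) * lam / (1 + (k : ℝ) * lam / (1 + x) ^ d) ^ d)
    (xhat : ℝ) (hxhat : xhat = 1 / ((d : ℝ) - 1)) :
    g xhat = xhat ∧
    deriv g xhat = 1 ∧
    iteratedDeriv 2 g xhat = 0 ∧
    iteratedDeriv 3 g xhat = -(((d : ℝ) + 1) * ((d : ℝ) - 1) ^ 3 / (d : ℝ) ^ 2) := by
  have hd1 : (0 : ℝ) < (d : ℝ) - 1 := by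
    have : (2 : ℝ) ≤ d := by exact_mod_cast hd
    linarith
  have hd0 : (0 : ℝ) < d := by linarith
  have hk0 : (0 : ℝ) < k := by exact_mod_cast hk
  obtain ⟨c, hc⟩ : ∃ c, c = (k : ℝ) * lam := ⟨_, rfl⟩
  have hc' : c = (d : ℝ) ^ d / ((d : ℝ) - 1) ^ (d + 1) := by
    rw [hc, hlam]
    field_simp
  have hcpos : 0 < c := by rw [hc']; positivity
  simp only [← hc] at hg
  set y : ℝ → ℝ := fun x => c / (1 + x) ^ d with hy
  have hgy : g = fun x => y (y x) := funext hg
  have hone : 1 + xhat = d / ((d : ℝ) - 1) := by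
    rw [hxhat]
    field_simp
    ring
  have hyx : y xhat = xhat := by
    simp only [hy]
    rw [hone, hc', hxhat, div_pow, pow_succ]
    field_simp
  have hypos : ∀ x ∈ Set.Ioi (-1 : ℝ), 0 < 1 + x ∧ 0 < y x := by
    intro x hx
    have h : 0 < 1 + x := by linarith [Set.mem_Ioi.mp hx]
    exact ⟨h, by simp only [hy]; positivity⟩
  have hdy : ∀ x : ℝ, 0 < 1 + x → HasDerivAt y (-d * y x / (1 + x)) x :=
    fun x hx => hasDerivAt_div_one_add_pow c d hx.ne'
  have hgx : g xhat = xhat := by simp only [hgy, hyx]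
  have hmem : xhat ∈ Set.Ioi (-1 : ℝ) := by
    have : 0 < 1 + xhat := by rw [hone]; positivity
    rw [Set.mem_Ioi]
    linarith
  obtain ⟨h1, h2, h3⟩ := derivs_of_logistic_system (d := d) (z := g)
    (w := fun x => y x / (1 + y x)) (u := fun x => (1 + x)⁻¹) isOpen_Ioi
    (fun x hx => by
      obtain ⟨hx1, hx2⟩ := hypos x hx
      have hx3 : 0 < 1 + y x := by linarith
      rw [hgy]
      refine HasDerivAt.congr_deriv ((hdy (y x) hx3).comp x (hdy x hx1)) ?_
      field_simp)
    (fun x hx => by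
      obtain ⟨hx1, hx2⟩ := hypos x hx
      have hx3 : 0 < 1 + y x := by linarith
      refine HasDerivAt.congr_deriv ((hdy x hx1).div ((hdy x hx1).const_add 1) hx3.ne') ?_
      field_simp
      ring)
    (fun x hx => by
      have hx1 := (hypos x hx).1
      refine HasDerivAt.congr_deriv (((hasDerivAt_id x).const_add 1).inv hx1.ne') ?_
      simp only [id]
      field_simp)
    hmem
  have hw : xhat / (1 + xhat) = 1 / d := by
    rw [hone, hxhat]
    field_simp
  have hu : (1 + xhat)⁻¹ = ((d : ℝ) - 1) / d := by rw [hone, inv_div]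
  simp only [hgx, hyx, hw, hu] at h1 h2 h3
  have hzero : (d : ℝ) * (1 / d) - 1 = 0 := by
    field_simp
    ring
  refine ⟨hgx, ?_, ?_, ?_⟩
  · rw [h1, hxhat]
    field_simp
  · rw [h2, hzero]
    ring
  · rw [h3, hzero, hxhat]
    field_simp
    ring
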